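/- Theorem (stationary points of the penalized factored objective have unit Frobenius norm): Set λ = Σ_{i=1}^m f_i and assume λ ≠ 0. Let U be a d × r complex matrix with Re(tr(Uᴴ A_i U)) > 0 for every i with f_i > 0, satisfying the stationarity equation λ·U = Σ_{i=1}^m (f_i / Re(tr(Uᴴ A_i U)))·(A_i U) (terms with f_i = 0 contribute the zero matrix). Then ‖U‖_F² = Re(tr(Uᴴ U)) = 1; equivalently, ρ = U Uᴴ satisfies tr(ρ) = 1. -/

import Mathlib

open Matrix BigOperators ComplexOrder

/-- Theorem: any stationary point `U` of the penalized factored objective, i.e. a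
solution of `λ·U = Σ_i (f_i / Re(tr(Uᴴ A_i U)))·(A_i U)` with `λ = Σ f_i ≠ 0`,
has unit Frobenius norm: `‖U‖_F² = Re(tr(Uᴴ U)) = 1`; equivalently,
`ρ = U Uᴴ` satisfies `tr ρ = 1`. -/
theorem unit_norm_of_stationary {d r m : ℕ} (hd : 1 ≤ d) (hr : 1 ≤ r) (hm : 1 ≤ m)
    (A : Fin m → Matrix (Fin d) (Fin d) ℂ) (f : Fin m → ℝ)
    (hA : ∀ i, (A i).PosSemidef) (hf : ∀ i, 0 ≤ f i)
    (hlam : (∑ i, f i) ≠ 0)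
    (U : Matrix (Fin d) (Fin r) ℂ)
    (hpos : ∀ i, 0 < f i → 0 < ((Uᴴ * A i * U).trace).re)
    (hstat : (∑ i, f i) • U = ∑ i, (f i / ((Uᴴ * A i * U).trace).re) • (A i * U)) :
    ((Uᴴ * U).trace).re = 1 ∧ (U * Uᴴ).trace = 1 := by
  have h1 : ((Uᴴ * U).trace).re = 1 := by
    have h := congrArg (fun M => ((Uᴴ * M).trace).re) hstat
    simp only [Matrix.mul_smul, Matrix.mul_sum, Matrix.trace_smul, Matrix.trace_sum,
      Complex.re_sum, Complex.smul_re, ← Matrix.mul_assoc, smul_eq_mul] at h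
    have h2 : ∑ i, f i / ((Uᴴ * A i * U).trace).re * ((Uᴴ * A i * U).trace).re = ∑ i, f i := by
      refine Finset.sum_congr rfl fun i _ => ?_
      rcases (hf i).eq_or_lt with h0 | h0
      · simp [← h0]
      · exact div_mul_cancel₀ _ (hpos i h0).ne'
    rw [h2] at h
    exact mul_left_cancel₀ hlam (by rw [h, mul_one])
  refine ⟨h1, ?_⟩
  rw [Matrix.trace_mul_comm]
  apply Complex.ext
  · simpa using h1
  · have h3 : star ((Uᴴ * U).trace) = (Uᴴ * U).trace := by
      rw [← Matrix.trace_conjTranspose, Matrix.conjTranspose_mul, Matrix.conjTranspose_conjTranspose]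
    have h4 := Complex.conj_eq_iff_im.mp h3
    simpa using h4
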